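/- Let β : ℝ → ℝ be C¹ with β(0) = 0, let M > 0, and set β_M := sup{|β'(r)| : |r| ≤ M}. Let u₁, u₂ ∈ L²(ℝ^d) ∩ L^∞(ℝ^d) with ‖u₁‖_∞ ≤ M and ‖u₂‖_∞ ≤ M, and put u := u₁ − u₂. Then |⟨β∘u₁ − β∘u₂, u⟩_{-1}| ≤ β_M ‖u‖_{L²}^{3/2} ‖u‖_{H^{-2}}^{1/2}, where for f, g ∈ L²(ℝ^d), ⟨f, g⟩_{-1} := ∫_{ℝ^d} (1 + 4π²‖ξ‖²)^{-1} 𝓕f(ξ) \overline{𝓕g(ξ)} dξ. -/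

import Mathlib

open MeasureTheory Real Set ComplexConjugate

noncomputable section

/-- The Fourier transform `𝓕g(ξ) = ∫ e^{-2πi⟨x,ξ⟩} g(x) dx` of a real-valued function
on `ℝ^d`. -/
noncomputable def FT {d : ℕ} (g : EuclideanSpace ℝ (Fin d) → ℝ) :
    EuclideanSpace ℝ (Fin d) → ℂ :=
  FourierTransform.fourier (fun x => (g x : ℂ))

open scoped FourierTransform SchwartzMap ContDiff in
/-- On `L¹ ∩ L²` the Fourier integral agrees almost everywhere with the `L²` Fourier transform. -/
theorem fourier_toLp_ae_eq_fourier {E : Type*} [NormedAddCommGroup E] [InnerProductSpace ℝ E]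
    [FiniteDimensional ℝ E] [MeasurableSpace E] [BorelSpace E] {f : E → ℂ}
    (hf₁ : Integrable f) (hf₂ : MemLp f 2) :
    (𝓕 (hf₂.toLp f) : Lp ℂ 2 (volume : Measure E)) =ᵐ[volume] 𝓕 f := by
  have hcont : Continuous (𝓕 f) :=
    VectorFourier.fourierIntegral_continuous Real.continuous_fourierChar
      (innerSL ℝ).continuous₂ hf₁
  refine ae_eq_of_integral_contDiff_smul_eq ((Lp.memLp _).locallyIntegrable one_le_two)
    hcont.locallyIntegrable fun g g_smooth g_cpt => ?_
  have hg₁ : HasCompactSupport (Complex.ofRealCLM ∘ g) := g_cpt.comp_left rfl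
  have hg₂ : ContDiff ℝ ∞ (Complex.ofRealCLM ∘ g) := by fun_prop
  set φ : 𝓢(E, ℂ) := hg₁.toSchwartzMap hg₂ with hφ
  have hflip : ∫ ξ, 𝓕 (φ : E → ℂ) ξ • f ξ = ∫ x, φ x • 𝓕 f x := by
    simpa using! VectorFourier.integral_fourierIntegral_smul_eq_flip (L := innerₗ E)
      Real.continuous_fourierChar continuous_inner φ.integrable hf₁
  have hdist := DFunLike.congr_fun (Lp.fourier_toTemperedDistribution_eq (hf₂.toLp f)) φ
  rw [TemperedDistribution.fourier_apply, Lp.toTemperedDistribution_apply,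
    Lp.toTemperedDistribution_apply] at hdist
  calc ∫ x, g x • (𝓕 (hf₂.toLp f) : Lp ℂ 2 (volume : Measure E)) x
      = ∫ x, φ x • (𝓕 (hf₂.toLp f) : Lp ℂ 2 (volume : Measure E)) x := by simp [hφ]
    _ = ∫ x, (𝓕 φ) x • (hf₂.toLp f) x := hdist.symm
    _ = ∫ x, 𝓕 (φ : E → ℂ) x • f x := by
        refine integral_congr_ae ?_
        filter_upwards [hf₂.coeFn_toLp] with x hx
        rw [hx, SchwartzMap.fourier_coe]
    _ = ∫ x, φ x • 𝓕 f x := hflip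
    _ = ∫ x, g x • 𝓕 f x := by simp [hφ]

open scoped FourierTransform in
theorem memLp_two_fourier {E : Type*} [NormedAddCommGroup E] [InnerProductSpace ℝ E]
    [FiniteDimensional ℝ E] [MeasurableSpace E] [BorelSpace E] {f : E → ℂ}
    (hf₁ : Integrable f) (hf₂ : MemLp f 2) : MemLp (𝓕 f) 2 :=
  (memLp_congr_ae (fourier_toLp_ae_eq_fourier hf₁ hf₂)).1 (Lp.memLp _)

theorem integral_norm_sq_eq_lpNorm_sq {α E : Type*} [MeasurableSpace α] {μ : Measure α}
    [NormedAddCommGroup E] {f : α → E} (hf : AEStronglyMeasurable f μ) :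
    ∫ x, ‖f x‖ ^ 2 ∂μ = lpNorm f 2 μ ^ 2 := by
  have h0 : 0 ≤ ∫ x, ‖f x‖ ^ 2 ∂μ := integral_nonneg fun x => by positivity
  rw [lpNorm_eq_integral_norm_rpow_toReal two_ne_zero ENNReal.ofNat_ne_top hf]
  simp only [ENNReal.toReal_ofNat, Real.rpow_ofNat]
  rw [← Real.rpow_natCast, ← Real.rpow_mul h0]
  norm_num

open scoped FourierTransform in
/-- Plancherel's theorem for the Fourier integral on `L¹ ∩ L²`. -/
theorem integral_norm_sq_fourier {E : Type*} [NormedAddCommGroup E] [InnerProductSpace ℝ E]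
    [FiniteDimensional ℝ E] [MeasurableSpace E] [BorelSpace E] {f : E → ℂ}
    (hf₁ : Integrable f) (hf₂ : MemLp f 2) :
    ∫ ξ, ‖𝓕 f ξ‖ ^ 2 = ∫ x, ‖f x‖ ^ 2 := by
  rw [integral_norm_sq_eq_lpNorm_sq (memLp_two_fourier hf₁ hf₂).1,
    integral_norm_sq_eq_lpNorm_sq hf₂.1, ← toReal_eLpNorm (memLp_two_fourier hf₁ hf₂).1,
    ← toReal_eLpNorm hf₂.1, ← Lp.norm_toLp f hf₂, ← Lp.norm_fourier_eq, Lp.norm_def,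
    eLpNorm_congr_ae (fourier_toLp_ae_eq_fourier hf₁ hf₂)]

theorem abs_sub_le_sSup_abs_deriv_mul {β : ℝ → ℝ} (hβ : ContDiff ℝ 1 β) {M r s : ℝ}
    (hr : |r| ≤ M) (hs : |s| ≤ M) :
    |β r - β s| ≤ sSup ((fun r => |deriv β r|) '' Icc (-M) M) * |r - s| := by
  have hbdd : BddAbove ((fun r => |deriv β r|) '' Icc (-M) M) :=
    (isCompact_Icc.image (hβ.continuous_deriv le_rfl).abs).bddAbove
  exact (convex_Icc (-M) M).norm_image_sub_le_of_norm_deriv_le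
    (fun x _ => (hβ.differentiable one_ne_zero) x)
    (fun x hx => le_csSup hbdd ⟨x, hx, rfl⟩) (abs_le.1 hs) (abs_le.1 hr)

theorem FT_eq_zero_of_not_integrable {d : ℕ} {g : EuclideanSpace ℝ (Fin d) → ℝ}
    (hg : ¬ Integrable g) : FT g = 0 := by
  funext ξ
  refine integral_undef fun h => hg ?_
  exact (Real.fourierIntegral_convergent_iff ξ).1 h |>.re

theorem memLp_two_FT {d : ℕ} {g : EuclideanSpace ℝ (Fin d) → ℝ}
    (hg₁ : Integrable g) (hg₂ : MemLp g 2) : MemLp (FT g) 2 :=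
  memLp_two_fourier hg₁.ofReal hg₂.ofReal

theorem integral_norm_sq_FT {d : ℕ} {g : EuclideanSpace ℝ (Fin d) → ℝ}
    (hg₁ : Integrable g) (hg₂ : MemLp g 2) : ∫ ξ, ‖FT g ξ‖ ^ 2 = ∫ x, g x ^ 2 := by
  simpa [FT] using integral_norm_sq_fourier hg₁.ofReal (hg₂.ofReal (K := ℂ))

/-- The interpolation estimate `|⟨f, g⟩_{-1}| ≤ ‖f‖_{L²} ‖g‖_{L²}^{1/2} ‖g‖_{H^{-2}}^{1/2}`, for a
general Fourier weight `w ∈ [0, 1]`. -/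
theorem norm_integral_weight_mul_mul_conj_le {α : Type*} [MeasurableSpace α] {μ : Measure α}
    {w : α → ℝ} {F G : α → ℂ} (hw : Measurable w) (hw0 : ∀ ξ, 0 ≤ w ξ) (hw1 : ∀ ξ, w ξ ≤ 1)
    (hF : MemLp F 2 μ) (hG : MemLp G 2 μ) :
    ‖∫ ξ, (w ξ : ℂ) * (F ξ * conj (G ξ)) ∂μ‖ ≤
      (∫ ξ, ‖F ξ‖ ^ 2 ∂μ) ^ ((1 : ℝ) / 2) * (∫ ξ, ‖G ξ‖ ^ 2 ∂μ) ^ ((1 : ℝ) / 4) *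
        (∫ ξ, w ξ ^ 2 * ‖G ξ‖ ^ 2 ∂μ) ^ ((1 : ℝ) / 4) := by
  have hwG : MemLp (fun ξ => (w ξ : ℂ) * G ξ) 2 μ := by
    refine hG.of_le ((Complex.measurable_ofReal.comp hw).aestronglyMeasurable.mul hG.1)
      (.of_forall fun ξ => ?_)
    rw [norm_mul, Complex.norm_of_nonneg (hw0 ξ)]
    exact mul_le_of_le_one_left (norm_nonneg _) (hw1 ξ)
  have hnorm (ξ : α) : ‖(w ξ : ℂ) * G ξ‖ ^ 2 = w ξ ^ 2 * ‖G ξ‖ ^ 2 := by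
    rw [norm_mul, Complex.norm_of_nonneg (hw0 ξ), mul_pow]
  have hle : ∫ ξ, w ξ ^ 2 * ‖G ξ‖ ^ 2 ∂μ ≤ ∫ ξ, ‖G ξ‖ ^ 2 ∂μ := by
    refine integral_mono_of_nonneg (.of_forall fun ξ => by positivity)
      (hG.integrable_norm_pow two_ne_zero) (.of_forall fun ξ => ?_)
    exact mul_le_of_le_one_left (by positivity) (pow_le_one₀ (hw0 ξ) (hw1 ξ))
  have hB : 0 ≤ ∫ ξ, w ξ ^ 2 * ‖G ξ‖ ^ 2 ∂μ := integral_nonneg fun ξ => by positivity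
  have hA : 0 ≤ ∫ ξ, ‖F ξ‖ ^ 2 ∂μ := integral_nonneg fun ξ => by positivity
  calc ‖∫ ξ, (w ξ : ℂ) * (F ξ * conj (G ξ)) ∂μ‖
      ≤ ∫ ξ, ‖F ξ‖ * ‖(w ξ : ℂ) * G ξ‖ ∂μ := by
        refine (norm_integral_le_integral_norm _).trans_eq (integral_congr_ae (.of_forall fun ξ => ?_))
        simp only [norm_mul, RCLike.norm_conj]
        ring
    _ ≤ (∫ ξ, ‖F ξ‖ ^ 2 ∂μ) ^ ((1 : ℝ) / 2) *
          (∫ ξ, w ξ ^ 2 * ‖G ξ‖ ^ 2 ∂μ) ^ ((1 : ℝ) / 2) := by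
        simp only [← hnorm]
        simpa only [Real.rpow_ofNat] using
          integral_mul_norm_le_Lp_mul_Lq (p := 2) (q := 2) Real.HolderConjugate.two_two
            (by simpa using hF) (by simpa using hwG)
    _ = (∫ ξ, ‖F ξ‖ ^ 2 ∂μ) ^ ((1 : ℝ) / 2) *
          (∫ ξ, w ξ ^ 2 * ‖G ξ‖ ^ 2 ∂μ) ^ ((1 : ℝ) / 4) *
          (∫ ξ, w ξ ^ 2 * ‖G ξ‖ ^ 2 ∂μ) ^ ((1 : ℝ) / 4) := by
        rw [mul_assoc, ← Real.rpow_add_of_nonneg hB (by norm_num) (by norm_num)]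
        norm_num
    _ ≤ _ := by gcongr

/-- for `β ∈ C¹` with `β(0) = 0`, `β_M = sup_{|r| ≤ M}|β'(r)|`, and
`u₁, u₂ ∈ L² ∩ L^∞` with `‖uᵢ‖_∞ ≤ M`, setting `u = u₁ − u₂`, one has
`|⟨β∘u₁ − β∘u₂, u⟩_{-1}| ≤ β_M ‖u‖_{L²}^{3/2} ‖u‖_{H^{-2}}^{1/2}`, where
`⟨f,g⟩_{-1} = ∫ (1+4π²‖ξ‖²)^{-1} 𝓕f(ξ) conj(𝓕g(ξ)) dξ`. -/
theorem beta_difference_H_neg_one_pairing_bound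
    {d : ℕ} (β : ℝ → ℝ) (hβ : ContDiff ℝ 1 β) (hβ0 : β 0 = 0)
    (M : ℝ) (hM : 0 < M)
    (u₁ u₂ : EuclideanSpace ℝ (Fin d) → ℝ)
    (hu₁ : MemLp u₁ 2 (volume : Measure (EuclideanSpace ℝ (Fin d))))
    (hu₂ : MemLp u₂ 2 (volume : Measure (EuclideanSpace ℝ (Fin d))))
    (hu₁M : ∀ᵐ x : EuclideanSpace ℝ (Fin d), |u₁ x| ≤ M)
    (hu₂M : ∀ᵐ x : EuclideanSpace ℝ (Fin d), |u₂ x| ≤ M) :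
    ‖∫ ξ : EuclideanSpace ℝ (Fin d),
        ((1 + 4 * π ^ 2 * ‖ξ‖ ^ 2 : ℝ) : ℂ)⁻¹ *
          (FT (fun x => β (u₁ x) - β (u₂ x)) ξ * conj (FT (fun x => u₁ x - u₂ x) ξ))‖
      ≤ sSup ((fun r => |deriv β r|) '' Icc (-M) M) *
        (∫ x : EuclideanSpace ℝ (Fin d), (u₁ x - u₂ x) ^ 2) ^ ((3 : ℝ) / 4) *
        (∫ ξ : EuclideanSpace ℝ (Fin d),
            ((1 + 4 * π ^ 2 * ‖ξ‖ ^ 2)⁻¹) ^ 2 *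
              ‖FT (fun x => u₁ x - u₂ x) ξ‖ ^ 2) ^ ((1 : ℝ) / 4) := by
  set C := sSup ((fun r => |deriv β r|) '' Icc (-M) M) with hC
  have hC0 : 0 ≤ C := Real.sSup_nonneg (by rintro _ ⟨r, -, rfl⟩; positivity)
  have hu : MemLp (fun x => u₁ x - u₂ x) 2 := hu₁.sub hu₂
  have hX : 0 ≤ ∫ x : EuclideanSpace ℝ (Fin d), (u₁ x - u₂ x) ^ 2 :=
    integral_nonneg fun x => by positivity
  by_cases hint : Integrable (fun x => u₁ x - u₂ x)
  swap
  · rw [FT_eq_zero_of_not_integrable hint]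
    simp only [Pi.zero_apply, map_zero, mul_zero, integral_zero, norm_zero]
    positivity
  have hlip : ∀ᵐ x, ‖β (u₁ x) - β (u₂ x)‖ ≤ C * ‖u₁ x - u₂ x‖ := by
    filter_upwards [hu₁M, hu₂M] with x h₁ h₂
    exact abs_sub_le_sSup_abs_deriv_mul hβ h₁ h₂
  have hmeas : AEStronglyMeasurable (fun x => β (u₁ x) - β (u₂ x)) :=
    (hβ.continuous.comp_aestronglyMeasurable hu₁.1).sub
      (hβ.continuous.comp_aestronglyMeasurable hu₂.1)
  have hf₂ : MemLp (fun x => β (u₁ x) - β (u₂ x)) 2 := hu.of_le_mul hmeas hlip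
  have hf₁ : Integrable (fun x => β (u₁ x) - β (u₂ x)) :=
    (hint.norm.const_mul C).mono' hmeas hlip
  have hle : ∫ x, (β (u₁ x) - β (u₂ x)) ^ 2 ≤ C ^ 2 * ∫ x, (u₁ x - u₂ x) ^ 2 := by
    rw [← integral_const_mul]
    refine integral_mono_of_nonneg (.of_forall fun x => by positivity)
      (hu.integrable_sq.const_mul _) ?_
    filter_upwards [hlip] with x hx
    simpa [mul_pow] using pow_le_pow_left₀ (norm_nonneg _) hx 2
  have hw (ξ : EuclideanSpace ℝ (Fin d)) : 1 ≤ 1 + 4 * π ^ 2 * ‖ξ‖ ^ 2 :=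
    le_add_of_nonneg_right (by positivity)
  have key := norm_integral_weight_mul_mul_conj_le (μ := volume)
    (w := fun ξ : EuclideanSpace ℝ (Fin d) => (1 + 4 * π ^ 2 * ‖ξ‖ ^ 2)⁻¹)
    (by fun_prop) (fun ξ => by positivity) (fun ξ => inv_le_one_of_one_le₀ (hw ξ))
    (memLp_two_FT hf₁ hf₂) (memLp_two_FT hint hu)
  rw [integral_norm_sq_FT hf₁ hf₂, integral_norm_sq_FT hint hu] at key
  simp only [Complex.ofReal_inv] at key
  refine key.trans (mul_le_mul_of_nonneg_right ?_ (by positivity))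
  calc (∫ x, (β (u₁ x) - β (u₂ x)) ^ 2) ^ ((1 : ℝ) / 2) *
        (∫ x, (u₁ x - u₂ x) ^ 2) ^ ((1 : ℝ) / 4)
      ≤ (C ^ 2 * ∫ x, (u₁ x - u₂ x) ^ 2) ^ ((1 : ℝ) / 2) *
        (∫ x, (u₁ x - u₂ x) ^ 2) ^ ((1 : ℝ) / 4) := by
        gcongr
    _ = C * (∫ x, (u₁ x - u₂ x) ^ 2) ^ ((3 : ℝ) / 4) := by
        rw [Real.mul_rpow (by positivity) hX, ← Real.sqrt_eq_rpow (C ^ 2), Real.sqrt_sq hC0,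
          mul_assoc, ← Real.rpow_add_of_nonneg hX (by norm_num) (by norm_num)]
        norm_num

end
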